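/- Let a be an integer such that −a is not the square of any integer. Then there exists a constant K_a such that for every real M ≥ K_a and all integers τ and N, the set {m ∈ ℤ : |m − τ| < M and a m² + n² = N for some n ∈ ℤ} has cardinality at most 100·√M·log M. -/

import Mathlib

section

open Finset ComplexConjugate
open scoped NumberTheorySymbols
open ArithmeticFunction (vonMangoldt)

/-- Parseval's identity on `ZMod N`. -/
lemma ZMod.sum_norm_sq_fourier {N : ℕ} [NeZero N] (F : ZMod N → ℂ) :
    ∑ b, ‖∑ h, F h * ZMod.stdAddChar (h * b)‖ ^ 2 = N * ∑ h, ‖F h‖ ^ 2 := by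
  have key : ∀ b : ZMod N, ((‖∑ h, F h * ZMod.stdAddChar (h * b)‖ ^ 2 : ℝ) : ℂ) =
      ∑ h, ∑ h', F h * conj (F h') * ZMod.stdAddChar (b * (h - h')) := by
    intro b
    push_cast
    rw [← Complex.mul_conj', map_sum, Finset.sum_mul_sum]
    refine Finset.sum_congr rfl fun h _ ↦ Finset.sum_congr rfl fun h' _ ↦ ?_
    rw [map_mul (starRingEnd ℂ), mul_sub, sub_eq_add_neg, AddChar.map_add_eq_mul,
      AddChar.map_neg_eq_conj,
      mul_comm b h, mul_comm b h']
    ring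
  apply Complex.ofReal_injective
  push_cast [key]
  rw [Finset.sum_comm]
  simp_rw [Finset.sum_comm (s := (univ : Finset (ZMod N))) (t := univ)
    (f := fun b h' ↦ F _ * conj (F h') * ZMod.stdAddChar (b * (_ - h')))]
  rw [Finset.mul_sum]
  refine Finset.sum_congr rfl fun h _ ↦ ?_
  simp_rw [← Finset.mul_sum, AddChar.sum_mulShift _ (ZMod.isPrimitive_stdAddChar N), sub_eq_zero]
  simp [ZMod.card, Complex.mul_conj', mul_comm]

/-- The Fourier transform of a finitely supported sequence on `ℤ`, as a Fourier transform on
`ZMod N`. -/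
lemma ZMod.sum_norm_sq_fourier_int {N : ℕ} [NeZero N] (S : Finset ℤ) (a : ℤ → ℂ) :
    ∑ b : ZMod N, ‖∑ n ∈ S, a n * ZMod.stdAddChar ((n : ZMod N) * b)‖ ^ 2 =
      N * ∑ h : ZMod N, ‖∑ n ∈ S with ((n : ℤ) : ZMod N) = h, a n‖ ^ 2 := by
  rw [← ZMod.sum_norm_sq_fourier]
  refine Finset.sum_congr rfl fun b _ ↦ ?_
  rw [← Finset.sum_fiberwise S (fun n : ℤ ↦ (n : ZMod N))]
  congr 2
  refine Finset.sum_congr rfl fun h _ ↦ ?_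
  rw [Finset.sum_mul]
  refine Finset.sum_congr rfl fun n hn ↦ ?_
  rw [(Finset.mem_filter.mp hn).2]

/-- If a finite set of integers occupies at most two thirds of the residue classes modulo `p`,
then the nonzero frequencies modulo `p` carry a positive proportion of the mass. -/
lemma half_norm_sq_sum_le {p : ℕ} [NeZero p] (S : Finset ℤ)
    (hS : 3 * #(S.image (fun n : ℤ ↦ (n : ZMod p))) ≤ 2 * p) (a : ℤ → ℂ) :
    ‖∑ n ∈ S, a n‖ ^ 2 / 2 ≤
      ∑ b ∈ univ.erase (0 : ZMod p),
        ‖∑ n ∈ S, a n * ZMod.stdAddChar ((n : ZMod p) * b)‖ ^ 2 := by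
  have h1 := ZMod.sum_norm_sq_fourier_int (N := p) S a
  rw [← Finset.add_sum_erase _ _ (Finset.mem_univ (0 : ZMod p))] at h1
  simp only [mul_zero, AddChar.map_zero_eq_one, mul_one] at h1
  set I := S.image (fun n : ℤ ↦ (n : ZMod p)) with hI
  set Z : ZMod p → ℂ := fun h ↦ ∑ n ∈ S with ((n : ℤ) : ZMod p) = h, a n with hZ
  have h2 : ∑ n ∈ S, a n = ∑ h ∈ I, Z h :=
    (Finset.sum_fiberwise_of_maps_to (fun n hn ↦ Finset.mem_image_of_mem _ hn) _).symm
  have h3 : ‖∑ n ∈ S, a n‖ ^ 2 ≤ #I * ∑ h, ‖Z h‖ ^ 2 := by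
    rw [h2]
    calc ‖∑ h ∈ I, Z h‖ ^ 2 ≤ (∑ h ∈ I, ‖Z h‖) ^ 2 := by gcongr; exact norm_sum_le _ _
      _ ≤ #I * ∑ h ∈ I, ‖Z h‖ ^ 2 := sq_sum_le_card_mul_sum_sq
      _ ≤ _ := by
        gcongr
        exact Finset.subset_univ _
  have h4 : (3 * #I : ℝ) ≤ 2 * p := by exact_mod_cast hS
  have h5 : 0 ≤ ∑ h, ‖Z h‖ ^ 2 := by positivity
  have h6 := mul_le_mul_of_nonneg_right h4 h5
  linarith

lemma re_stdAddChar_ge {T : ℕ} [NeZero T] {j : ℤ} (h : 6 * |j| ≤ T) :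
    1 / 2 ≤ (ZMod.stdAddChar (j : ZMod T) : ℂ).re := by
  have hT : (0 : ℝ) < T := by exact_mod_cast NeZero.pos T
  rw [ZMod.stdAddChar_coe, show 2 * (Real.pi : ℂ) * Complex.I * j / T =
    ((2 * Real.pi * j / T : ℝ) : ℂ) * Complex.I by push_cast; ring, Complex.exp_ofReal_mul_I_re,
    ← Real.cos_abs, ← Real.cos_pi_div_three]
  have h' : 6 * |(j : ℝ)| ≤ T := by exact_mod_cast h
  apply Real.cos_le_cos_of_nonneg_of_le_pi (abs_nonneg _) (by linarith [Real.pi_pos])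
  rw [abs_div, abs_mul, abs_of_pos hT, abs_of_pos (by positivity : 0 < 2 * Real.pi),
    div_le_iff₀ hT]
  nlinarith [Real.pi_pos]

/-- The large sieve inequality, with frequencies in `ZMod T` that are separated by at least `K`. -/
lemma large_sieve {ι : Type*} {T K : ℕ} [NeZero T] (hK : 0 < K) (S : Finset ℤ)
    (hS : ∀ n ∈ S, 6 * K * |n| ≤ T) (A : Finset ι) (α : ι → ZMod T)
    (hA : Set.InjOn (fun x : ι × ℕ ↦ α x.1 + x.2) (A ×ˢ range K : Finset (ι × ℕ)))
    (a : ℤ → ℂ) :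
    ∑ i ∈ A, ‖∑ n ∈ S, a n * ZMod.stdAddChar ((n : ZMod T) * α i)‖ ^ 2 ≤
      4 * T / K * ∑ n ∈ S, ‖a n‖ ^ 2 := by
  have hK' : (0 : ℝ) < K := by exact_mod_cast hK
  have hT' : (0 : ℤ) < T := by exact_mod_cast NeZero.pos T
  set g : ℤ → ℂ := fun n ↦ ∑ k ∈ range K, ZMod.stdAddChar ((n : ZMod T) * (k : ZMod T)) with hg
  have hgK : ∀ n ∈ S, (K : ℝ) / 2 ≤ ‖g n‖ := by
    intro n hn
    refine le_trans ?_ (Complex.re_le_norm _)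
    rw [hg, Complex.re_sum]
    calc (K : ℝ) / 2 = ∑ k ∈ range K, (1 / 2 : ℝ) := by simp; ring
      _ ≤ _ := by
        refine Finset.sum_le_sum fun k hk ↦ ?_
        have := re_stdAddChar_ge (T := T) (j := n * k) (by
          have h1 := hS n hn
          have h2 : (k : ℤ) ≤ K := by exact_mod_cast (Finset.mem_range.mp hk).le
          rw [abs_mul, Nat.abs_cast]
          nlinarith [abs_nonneg n])
        push_cast at this
        exact this
  have hg0 : ∀ n ∈ S, g n ≠ 0 := fun n hn h ↦ by
    have := hgK n hn
    rw [h, norm_zero] at this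
    linarith
  set b : ℤ → ℂ := fun n ↦ a n / g n with hb
  set B : ZMod T → ℂ := fun j ↦ ∑ n ∈ S, b n * ZMod.stdAddChar ((n : ZMod T) * j) with hB
  have h1 : ∀ i, ‖∑ n ∈ S, a n * ZMod.stdAddChar ((n : ZMod T) * α i)‖ ^ 2 ≤
      K * ∑ k ∈ range K, ‖B (α i + k)‖ ^ 2 := by
    intro i
    have : ∑ n ∈ S, a n * ZMod.stdAddChar ((n : ZMod T) * α i) =
        ∑ k ∈ range K, B (α i + k) := by
      rw [hB, Finset.sum_comm]
      refine Finset.sum_congr rfl fun n hn ↦ ?_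
      simp_rw [mul_add, AddChar.map_add_eq_mul, ← mul_assoc, ← Finset.mul_sum]
      rw [hb]
      change _ = a n / g n * _ * g n
      field_simp [hg0 n hn]
    rw [this]
    calc _ ≤ (∑ k ∈ range K, ‖B (α i + k)‖) ^ 2 := by gcongr; exact norm_sum_le _ _
      _ ≤ _ := by
        simpa using sq_sum_le_card_mul_sum_sq (s := range K) (f := fun k ↦ ‖B (α i + k)‖)
  have h2 : ∑ i ∈ A, ∑ k ∈ range K, ‖B (α i + k)‖ ^ 2 ≤ ∑ j, ‖B j‖ ^ 2 := by
    rw [← Finset.sum_product', ← Finset.sum_image (g := fun x : ι × ℕ ↦ α x.1 + x.2)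
      (f := fun j ↦ ‖B j‖ ^ 2) hA]
    exact Finset.sum_le_sum_of_subset_of_nonneg (Finset.subset_univ _) fun _ _ _ ↦ by positivity
  have hSinj : Set.InjOn (fun n : ℤ ↦ (n : ZMod T)) S := by
    intro m hm n hn hmn
    have hd := (ZMod.intCast_eq_intCast_iff_dvd_sub m n T).mp hmn
    have hm' := hS m hm
    have hn' := hS n hn
    have hK1 : (1 : ℤ) ≤ K := by exact_mod_cast hK
    have := Int.eq_zero_of_abs_lt_dvd hd (by
      have := abs_sub n m
      nlinarith [abs_nonneg n, abs_nonneg m])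
    linarith
  have h3 : ∑ j, ‖B j‖ ^ 2 = T * ∑ n ∈ S, ‖b n‖ ^ 2 := by
    rw [hB, ZMod.sum_norm_sq_fourier_int]
    congr 1
    rw [← Finset.sum_subset (Finset.subset_univ (S.image (fun n : ℤ ↦ (n : ZMod T)))),
      Finset.sum_image hSinj]
    · refine Finset.sum_congr rfl fun n hn ↦ ?_
      rw [show {m ∈ S | ((m : ℤ) : ZMod T) = n} = {n} by
        ext m
        simp only [Finset.mem_filter, Finset.mem_singleton]
        exact ⟨fun h ↦ hSinj h.1 hn h.2, fun h ↦ by rw [h]; exact ⟨hn, rfl⟩⟩]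
      simp
    · intro h _ hh
      rw [Finset.filter_eq_empty_iff.mpr]
      · simp
      · intro n hn hnh
        exact hh (Finset.mem_image.mpr ⟨n, hn, hnh⟩)
  have h4 : ∑ n ∈ S, ‖b n‖ ^ 2 ≤ 4 / K ^ 2 * ∑ n ∈ S, ‖a n‖ ^ 2 := by
    rw [Finset.mul_sum]
    refine Finset.sum_le_sum fun n hn ↦ ?_
    have h5 := hgK n hn
    rw [hb]
    simp only [norm_div, div_pow]
    rw [div_mul_eq_mul_div, div_le_div_iff₀ (by nlinarith) (by positivity)]
    have : (K : ℝ) ^ 2 ≤ 4 * ‖g n‖ ^ 2 := by nlinarith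
    nlinarith [sq_nonneg ‖a n‖]
  calc _ ≤ ∑ i ∈ A, K * ∑ k ∈ range K, ‖B (α i + k)‖ ^ 2 := Finset.sum_le_sum fun i _ ↦ h1 i
    _ = K * ∑ i ∈ A, ∑ k ∈ range K, ‖B (α i + k)‖ ^ 2 := by rw [Finset.mul_sum]
    _ ≤ K * (T * (4 / K ^ 2 * ∑ n ∈ S, ‖a n‖ ^ 2)) := by
      gcongr
      exact h2.trans (h3.le.trans (by gcongr))
    _ = _ := by field_simp

/-- An anisotropic conic `a m² + n² = N` over `ZMod p` has about `p / 2` abscissae. -/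
lemma card_conic_abscissae_le {p : ℕ} [Fact p.Prime] (hp : 19 ≤ p) (a N : ZMod p)
    (ha : ¬IsSquare (-a)) :
    3 * #{m : ZMod p | ∃ n, a * m ^ 2 + n ^ 2 = N} ≤ 2 * p := by
  classical
  set V : Finset (ZMod p) := {m : ZMod p | ∃ n, a * m ^ 2 + n ^ 2 = N} with hV
  rcases V.eq_empty_or_nonempty with h0 | ⟨m₀, hm₀⟩
  · simp [h0]
  have ha0 : a ≠ 0 := by
    rintro rfl
    exact ha (by simp)
  have hat : ∀ t : ZMod p, a + t ^ 2 ≠ 0 := fun t ht ↦ ha ⟨t, by linear_combination -ht⟩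
  have h2 : (2 : ZMod p) ≠ 0 := by
    intro h
    have := (ZMod.natCast_eq_zero_iff 2 p).mp (by exact_mod_cast h)
    have := Nat.le_of_dvd (by norm_num) this
    omega
  have hex : ∀ m : ZMod p, ∃ n, m ∈ V → a * m ^ 2 + n ^ 2 = N := by
    intro m
    by_cases hm : m ∈ V
    · obtain ⟨n, hn⟩ := (Finset.mem_filter.mp hm).2
      exact ⟨n, fun _ ↦ hn⟩
    · exact ⟨0, fun h ↦ absurd h hm⟩
  choose ν hν using hex
  set W : Finset (ZMod p) := {m : ZMod p | a * m ^ 2 = N} with hW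
  have hWcard : #W ≤ 2 := by
    rcases W.eq_empty_or_nonempty with h | ⟨m₁, hm₁⟩
    · simp [h]
    · refine (Finset.card_le_card (t := {m₁, -m₁}) fun m hm ↦ ?_).trans Finset.card_le_two
      have e1 := (Finset.mem_filter.mp hm₁).2
      have e2 := (Finset.mem_filter.mp hm).2
      have : m ^ 2 = m₁ ^ 2 := mul_left_cancel₀ ha0 (e2.trans e1.symm)
      simpa [sq_eq_sq_iff_eq_or_eq_neg] using this
  set V' : Finset (ZMod p) := {m ∈ V | m ≠ m₀ ∧ ν m ≠ 0} with hV'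
  have hVV' : #V ≤ #V' + 3 := by
    have hsub : V ⊆ V' ∪ ({m₀} ∪ W) := by
      intro m hm
      by_cases h1 : m = m₀
      · simp [h1]
      by_cases h3 : ν m = 0
      · have := hν m hm
        rw [h3] at this
        simp [hW, ← this]
      · simp [hV', hm, h1, h3]
    have := Finset.card_le_card hsub
    have := Finset.card_union_le V' ({m₀} ∪ W)
    have := Finset.card_union_le {m₀} W
    simp only [Finset.card_singleton] at this
    omega
  have hV'card : #V' * 2 ≤ p := by
    have hneg : (1 : ZMod p) ≠ -1 := by
      intro h
      apply h2
      linear_combination h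
    have hcard : #(V' ×ˢ ({1, -1} : Finset (ZMod p))) = #V' * 2 := by
      rw [Finset.card_product, Finset.card_pair hneg]
    rw [← hcard]
    have : #(univ : Finset (ZMod p)) = p := by simp [ZMod.card]
    conv_rhs => rw [← this]
    refine Finset.card_le_card_of_injOn (fun x ↦ (x.2 * ν x.1 - ν m₀) / (x.1 - m₀))
      (fun _ _ ↦ Finset.mem_coe.mpr (Finset.mem_univ _)) ?_
    have key : ∀ m ∈ V', ∀ ε : ZMod p, ε ^ 2 = 1 → ∀ t, (ε * ν m - ν m₀) / (m - m₀) = t →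
        (m - m₀) * (a + t ^ 2) = -2 * (a * m₀ + ν m₀ * t) ∧ ε * ν m = ν m₀ + t * (m - m₀) := by
      rintro m hm ε hε t ht
      obtain ⟨hm, hmm, -⟩ := Finset.mem_filter.mp hm
      have hne := sub_ne_zero.mpr hmm
      rw [div_eq_iff hne] at ht
      refine ⟨mul_left_cancel₀ hne ?_, by linear_combination ht⟩
      have e1 := hν m hm
      have e2 := hν m₀ hm₀
      have e3 : ε * ν m = ν m₀ + t * (m - m₀) := by linear_combination ht
      have e4 : ν m ^ 2 = (ν m₀ + t * (m - m₀)) ^ 2 := by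
        rw [← e3]; linear_combination (-(ν m) ^ 2) * hε
      linear_combination e1 - e2 - e4
    rintro ⟨m, ε⟩ hx ⟨m', ε'⟩ hx' hxx
    simp only [Finset.coe_product, Set.mem_prod, Finset.mem_coe] at hx hx' hxx
    have hε : ∀ ε ∈ ({1, -1} : Finset (ZMod p)), ε ^ 2 = 1 := by simp
    obtain ⟨k1, k2⟩ := key m hx.1 ε (hε _ hx.2) _ hxx
    obtain ⟨k1', k2'⟩ := key m' hx'.1 ε' (hε _ hx'.2) _ rfl
    have hmm : m = m' := by
      have := mul_right_cancel₀ (hat _) (k1.trans k1'.symm)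
      linear_combination this
    subst hmm
    have : ε = ε' :=
      mul_right_cancel₀ (Finset.mem_filter.mp hx.1).2.2 (k2.trans k2'.symm)
    rw [this]
  omega

lemma sum_Ico_one_eq_sum_erase_zero {p : ℕ} [NeZero p] {M : Type*} [AddCommMonoid M]
    (F : ZMod p → M) : ∑ b ∈ Ico 1 p, F b = ∑ b ∈ univ.erase (0 : ZMod p), F b := by
  refine Finset.sum_bij' (fun b _ ↦ (b : ZMod p)) (fun b _ ↦ b.val) ?_ ?_ ?_ ?_ ?_
  · intro b hb
    obtain ⟨h1, h2⟩ := Finset.mem_Ico.mp hb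
    simp only [Finset.mem_erase, Finset.mem_univ, and_true, ne_eq, ZMod.natCast_eq_zero_iff]
    exact Nat.not_dvd_of_pos_of_lt h1 h2
  · intro b hb
    have := (ZMod.val_ne_zero b).mpr (Finset.mem_erase.mp hb).1
    exact Finset.mem_Ico.mpr ⟨by omega, ZMod.val_lt b⟩
  · intro b hb
    exact ZMod.val_cast_of_lt (Finset.mem_Ico.mp hb).2
  · intro b _
    exact ZMod.natCast_zmod_val b
  · intro b _
    rfl

lemma stdAddChar_natCast_div {T p : ℕ} [NeZero T] [NeZero p] (h : p ∣ T) (n : ℤ) (b : ℕ) :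
    (ZMod.stdAddChar ((n : ZMod T) * ((T / p * b : ℕ) : ZMod T)) : ℂ) =
      ZMod.stdAddChar ((n : ZMod p) * (b : ZMod p)) := by
  obtain ⟨k, hk⟩ := h
  have hp : (p : ℂ) ≠ 0 := by exact_mod_cast NeZero.ne p
  have hT : (T : ℂ) ≠ 0 := by exact_mod_cast NeZero.ne T
  have e1 : T / p = k := by rw [hk]; exact Nat.mul_div_cancel_left k (NeZero.pos p)
  have e2 := ZMod.stdAddChar_coe (N := T) (n * (k * b : ℕ))
  have e3 := ZMod.stdAddChar_coe (N := p) (n * b)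
  push_cast at e2 e3
  rw [e1]
  push_cast
  rw [e2, e3]
  congr 1
  have : (T : ℂ) = p * k := by exact_mod_cast hk
  rw [div_eq_div_iff hT hp, this]
  ring

lemma quarter_card_sq_le {T p r : ℕ} [NeZero T] [NeZero p] [NeZero r] (hp : p ∣ T) (hr : r ∣ T)
    (S : Finset ℤ) (hSp : 3 * #(S.image (fun n : ℤ ↦ (n : ZMod p))) ≤ 2 * p)
    (hSr : 3 * #(S.image (fun n : ℤ ↦ (n : ZMod r))) ≤ 2 * r) :
    (#S : ℝ) ^ 2 / 4 ≤ ∑ y ∈ Ico 1 p ×ˢ Ico 1 r,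
      ‖∑ n ∈ S, (1 : ℂ) * ZMod.stdAddChar ((n : ZMod T) *
        ((T / p * y.1 + T / r * y.2 : ℕ) : ZMod T))‖ ^ 2 := by
  rw [Finset.sum_product_right]
  have h1 : ∀ c : ℕ, ‖∑ n ∈ S, (1 : ℂ) * ZMod.stdAddChar ((n : ZMod r) * (c : ZMod r))‖ ^ 2 / 2 ≤
      ∑ b ∈ Ico 1 p, ‖∑ n ∈ S, (1 : ℂ) * ZMod.stdAddChar ((n : ZMod T) *
        ((T / p * b + T / r * c : ℕ) : ZMod T))‖ ^ 2 := by
    intro c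
    refine (half_norm_sq_sum_le S hSp _).trans (le_of_eq ?_)
    rw [← sum_Ico_one_eq_sum_erase_zero]
    refine Finset.sum_congr rfl fun b _ ↦ ?_
    congr 2
    refine Finset.sum_congr rfl fun n _ ↦ ?_
    rw [Nat.cast_add, mul_add, AddChar.map_add_eq_mul, stdAddChar_natCast_div hp,
      stdAddChar_natCast_div hr]
    ring
  have h2 := half_norm_sq_sum_le S hSr (fun _ ↦ 1)
  rw [← sum_Ico_one_eq_sum_erase_zero] at h2
  simp only [Finset.sum_const, nsmul_eq_mul, mul_one, Complex.norm_natCast] at h2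
  calc (#S : ℝ) ^ 2 / 4 = (#S : ℝ) ^ 2 / 2 / 2 := by ring
    _ ≤ _ := div_le_div_of_nonneg_right h2 (by norm_num)
    _ ≤ _ := by
      rw [Finset.sum_div]
      exact Finset.sum_le_sum fun c _ ↦ h1 c

/-- Distinct fractions `b / p + c / r`, with `p, r` primes such that `p * r ≤ Q`, are at least
`1 / Q ^ 2` apart modulo one. -/
lemma frequencies_separated {Q K T : ℕ} (hT : T = Q ^ 2 * K)
    {p r p' r' b c b' c' k k' : ℕ} {j : ℤ} (hp : p.Prime) (hr : r.Prime) (hp' : p'.Prime)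
    (hr' : r'.Prime) (hrp : r < p) (hrp' : r' < p') (hpr : p * r ≤ Q) (hpr' : p' * r' ≤ Q)
    (hpT : p ∣ T) (hrT : r ∣ T) (hpT' : p' ∣ T) (hrT' : r' ∣ T)
    (hb : b ∈ Ico 1 p) (hc : c ∈ Ico 1 r) (hb' : b' ∈ Ico 1 p') (hc' : c' ∈ Ico 1 r')
    (hk : k < K) (hk' : k' < K)
    (h : ((T / p * b + T / r * c : ℕ) : ℤ) + k - (((T / p' * b' + T / r' * c' : ℕ) : ℤ) + k') =
      j * T) :
    p = p' ∧ r = r' ∧ b = b' ∧ c = c' ∧ k = k' := by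
  rw [Finset.mem_Ico] at hb hc hb' hc'
  have hK : 0 < K := by omega
  have hQ : 0 < Q := lt_of_lt_of_le (Nat.mul_pos hp.pos hr.pos) hpr
  have hT0 : 0 < T := by rw [hT]; positivity
  set X : ℤ := (b * r + c * p) * (p' * r') - (b' * r' + c' * p') * (p * r)
    - j * (p * r * p' * r') with hX
  have e : ∀ q : ℕ, q ∣ T → ((T / q : ℕ) : ℤ) * q = T := fun q hq ↦ by
    exact_mod_cast Nat.div_mul_cancel hq
  have hTX : (T : ℤ) * X = (k' - k) * (p * r * (p' * r')) := by
    push_cast at h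
    have e1 := e p hpT
    have e2 := e r hrT
    have e3 := e p' hpT'
    have e4 := e r' hrT'
    push_cast at e1 e2 e3 e4
    rw [hX]
    linear_combination (p * r * (p' * r') : ℤ) * h - (b * r * p' * r' : ℤ) * e1
      - (c * p * p' * r' : ℤ) * e2 + (b' * p * r * r' : ℤ) * e3 + (c' * p * r * p' : ℤ) * e4
  have hX0 : X = 0 := by
    have hlt : |(T : ℤ) * X| < T := by
      rw [hTX, abs_mul]
      have h1 : |(k' : ℤ) - k| < K := by rw [abs_lt]; constructor <;> omega
      have h2 : |(p * r * (p' * r') : ℤ)| ≤ Q ^ 2 := by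
        rw [abs_of_nonneg (by positivity)]
        have : p * r * (p' * r') ≤ Q * Q := Nat.mul_le_mul hpr hpr'
        rw [sq]
        exact_mod_cast this
      have h3 : (T : ℤ) = Q ^ 2 * K := by exact_mod_cast hT
      have hQ' : (0 : ℤ) < Q ^ 2 := by positivity
      calc _ ≤ |(k' : ℤ) - k| * Q ^ 2 := by gcongr
        _ < K * Q ^ 2 := by gcongr
        _ = T := by rw [h3]; ring
    have h0 := Int.eq_zero_of_abs_lt_dvd (dvd_mul_right (T : ℤ) X) hlt
    rcases mul_eq_zero.mp h0 with h | h
    · exact absurd h (by exact_mod_cast hT0.ne')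
    · exact h
  have hkk : k = k' := by
    rw [hX0, mul_zero, eq_comm, mul_eq_zero] at hTX
    rcases hTX with h | h
    · omega
    · exfalso
      have : 0 < p * r * (p' * r') :=
        Nat.mul_pos (Nat.mul_pos hp.pos hr.pos) (Nat.mul_pos hp'.pos hr'.pos)
      exact this.ne' (by exact_mod_cast h)
  have small : ∀ {q s : ℕ}, q.Prime → s ∈ Set.Ico 1 q → ¬ (q : ℤ) ∣ s := by
    intro q s _ hs hd
    exact Nat.not_dvd_of_pos_of_lt hs.1 hs.2 (by exact_mod_cast hd)
  have prime_dvd : ∀ {q s : ℕ}, q.Prime → s.Prime → (q : ℤ) ∣ s → q = s := by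
    intro q s hq hs hd
    exact (Nat.prime_dvd_prime_iff_eq hq hs).mp (by exact_mod_cast hd)
  have big : ∀ {q s t s' t' : ℕ}, q.Prime → s.Prime → s'.Prime → t'.Prime → t ∈ Set.Ico 1 q →
      (q : ℤ) ∣ t * s * (s' * t') → q = s ∨ q = s' ∨ q = t' := by
    intro q s t s' t' hq hs hs' ht' ht hd
    have hqp := Nat.prime_iff_prime_int.mp hq
    rcases hqp.dvd_or_dvd hd with h | h
    · rcases hqp.dvd_or_dvd h with h | h
      · exact absurd h (small hq ht)
      · exact Or.inl (prime_dvd hq hs h)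
    · rcases hqp.dvd_or_dvd h with h | h
      · exact Or.inr (Or.inl (prime_dvd hq hs' h))
      · exact Or.inr (Or.inr (prime_dvd hq ht' h))
  have c1 := big hp hr hp' hr' hb
    ⟨(b' * r' + c' * p') * r + j * (r * p' * r') - c * (p' * r'), by linear_combination hX0⟩
  have c2 := big hr hp hp' hr' hc
    ⟨(b' * r' + c' * p') * p + j * (p * p' * r') - b * (p' * r'), by linear_combination hX0⟩
  have c3 := big hp' hr' hp hr hb'
    ⟨(b * r + c * p) * r' - j * (p * r * r') - c' * (p * r), by linear_combination -hX0⟩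
  have hpp : p = p' := by omega
  have hrr : r = r' := by omega
  subst hpp hrr
  have hpr0 : (p * r : ℤ) ≠ 0 := by
    exact_mod_cast (Nat.mul_pos hp.pos hr.pos).ne'
  have hX1 : ((b : ℤ) - b') * r + (c - c') * p = j * (p * r) :=
    mul_right_cancel₀ hpr0 (by linear_combination hX0)
  have hcop : IsCoprime (p : ℤ) r :=
    Nat.isCoprime_iff_coprime.mpr ((Nat.coprime_primes hp hr).mpr hrp.ne')
  have hbb : (b : ℤ) - b' = 0 := by
    refine Int.eq_zero_of_abs_lt_dvd (m := p) (hcop.dvd_of_dvd_mul_right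
      ⟨j * r - (c - c'), by linear_combination hX1⟩) ?_
    rw [abs_lt]; constructor <;> omega
  have hcc : (c : ℤ) - c' = 0 := by
    refine Int.eq_zero_of_abs_lt_dvd (m := r) (hcop.symm.dvd_of_dvd_mul_right
      ⟨j * p - (b - b'), by linear_combination hX1⟩) ?_
    rw [abs_lt]; constructor <;> omega
  exact ⟨rfl, rfl, by omega, by omega, hkk⟩

/-- A sieve bound using moduli that are products of two primes. -/
lemma card_mul_card_le_of_sieve {Q : ℕ} (hQ : 0 < Q) (S : Finset ℤ)
    (hS : ∀ n ∈ S, 6 * |n| ≤ (Q : ℤ) ^ 2) (P : Finset (ℕ × ℕ))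
    (hP : ∀ x ∈ P, x.1.Prime ∧ x.2.Prime ∧ x.2 < x.1 ∧ x.1 * x.2 ≤ Q)
    (hres : ∀ x ∈ P, 3 * #(S.image (fun n : ℤ ↦ (n : ZMod x.1))) ≤ 2 * x.1 ∧
      3 * #(S.image (fun n : ℤ ↦ (n : ZMod x.2))) ≤ 2 * x.2) :
    (#S * #P : ℝ) ≤ 16 * Q ^ 2 := by
  set K := Q.factorial with hK
  set T := Q ^ 2 * K with hT
  have hK0 : 0 < K := Nat.factorial_pos Q
  have hT0 : 0 < T := by positivity
  have : NeZero T := ⟨hT0.ne'⟩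
  have hdvd : ∀ x ∈ P, x.1 ∣ T ∧ x.2 ∣ T := by
    intro x hx
    obtain ⟨h1, h2, -, h4⟩ := hP x hx
    exact ⟨(Nat.dvd_factorial h1.pos (by nlinarith [h2.pos])).mul_left _,
      (Nat.dvd_factorial h2.pos (by nlinarith [h1.pos])).mul_left _⟩
  set A : Finset (Σ _ : ℕ × ℕ, ℕ × ℕ) := P.sigma fun x ↦ Ico 1 x.1 ×ˢ Ico 1 x.2 with hA
  have hls := large_sieve (T := T) hK0 S (fun n hn ↦ by
      have := hS n hn
      rw [hT]
      push_cast
      nlinarith) A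
    (fun i ↦ ((T / i.1.1 * i.2.1 + T / i.1.2 * i.2.2 : ℕ) : ZMod T)) (by
      rintro ⟨⟨⟨p, r⟩, b, c⟩, k⟩ hx ⟨⟨⟨p', r'⟩, b', c'⟩, k'⟩ hx' hxx
      simp only [hA, Finset.coe_product, Set.mem_prod, Finset.mem_coe, Finset.mem_sigma,
        Finset.mem_product, Finset.mem_range] at hx hx' hxx
      obtain ⟨h1, h2, h3, h4⟩ := hP _ hx.1.1
      obtain ⟨h1', h2', h3', h4'⟩ := hP _ hx'.1.1
      obtain ⟨d1, d2⟩ := hdvd _ hx.1.1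
      obtain ⟨d1', d2'⟩ := hdvd _ hx'.1.1
      have hd := (ZMod.intCast_eq_intCast_iff_dvd_sub
        (((T / p' * b' + T / r' * c' : ℕ) : ℤ) + k') (((T / p * b + T / r * c : ℕ) : ℤ) + k) T).mp
        (by exact_mod_cast hxx.symm)
      obtain ⟨j, hj⟩ := hd
      obtain ⟨rfl, rfl, rfl, rfl, rfl⟩ := frequencies_separated hT h1 h2 h1' h2' h3 h3' h4 h4'
        d1 d2 d1' d2' hx.1.2.1 hx.1.2.2 hx'.1.2.1 hx'.1.2.2 hx.2 hx'.2 (j := j)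
        (by rw [hj, mul_comm])
      rfl) (fun _ ↦ 1)
  rw [hA, Finset.sum_sigma] at hls
  have hlow : (#P : ℝ) * ((#S : ℝ) ^ 2 / 4) ≤ 4 * T / K * #S := by
    refine le_trans ?_ (hls.trans (by simp))
    rw [← nsmul_eq_mul, ← Finset.sum_const]
    refine Finset.sum_le_sum fun x hx ↦ ?_
    obtain ⟨h1, h2, -, -⟩ := hP x hx
    have : NeZero x.1 := ⟨h1.ne_zero⟩
    have : NeZero x.2 := ⟨h2.ne_zero⟩
    exact quarter_card_sq_le (hdvd x hx).1 (hdvd x hx).2 S (hres x hx).1 (hres x hx).2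
  have hTK : 4 * (T : ℝ) / K = 4 * Q ^ 2 := by
    have : (K : ℝ) ≠ 0 := by exact_mod_cast hK0.ne'
    rw [hT]
    push_cast
    field_simp
  rw [hTK] at hlow
  rcases S.eq_empty_or_nonempty with rfl | hne
  · simp
  · have : (0 : ℝ) < #S := by exact_mod_cast hne.card_pos
    refine le_of_mul_le_mul_right ?_ this
    nlinarith

/-- A nonsquare integer has Jacobi symbol `-1` over some odd number. -/
lemma exists_jacobiSym_eq_neg_one {D : ℤ} (hD : ¬IsSquare D) :
    ∃ n : ℕ, Odd n ∧ J(D | n) = -1 := by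
  have hD0 : D ≠ 0 := by rintro rfl; exact hD (by simp)
  obtain ⟨d, b, hbd, hd⟩ := Nat.sq_mul_squarefree D.natAbs
  have hb0 : b ≠ 0 := by
    rintro rfl
    simp at hbd
    exact hD0 (Int.natAbs_eq_zero.mp hbd.symm)
  have hd0 : d ≠ 0 := hd.ne_zero
  obtain ⟨σ, hσ, hDσ⟩ : ∃ σ : ℤ, (σ = 1 ∨ σ = -1) ∧ D = σ * d * b ^ 2 := by
    have : (D.natAbs : ℤ) = b ^ 2 * d := by exact_mod_cast hbd.symm
    rcases Int.natAbs_eq D with h | h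
    · exact ⟨1, Or.inl rfl, by rw [h, this]; ring⟩
    · exact ⟨-1, Or.inr rfl, by rw [h, this]; ring⟩
  have hσabs : σ.natAbs = 1 := by rcases hσ with rfl | rfl <;> rfl
  suffices h : ∃ n : ℕ, Odd n ∧ b.Coprime n ∧ J(σ * d | n) = -1 by
    obtain ⟨n, hn, hbn, hJ⟩ := h
    refine ⟨n, hn, ?_⟩
    rw [hDσ, jacobiSym.mul_left, hJ, jacobiSym.sq_one' (by simpa using hbn)]
    rfl
  have coprime_of_modEq_one : ∀ {n m s : ℕ}, n ≡ 1 [MOD m] → s ∣ m → s.Coprime n := by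
    intro n m s h hs
    have := (h.of_dvd hs).gcd_eq
    rw [Nat.gcd_one_left] at this
    rwa [Nat.Coprime, Nat.gcd_comm]
  by_cases hℓ : ∃ ℓ : ℕ, ℓ.Prime ∧ ℓ ∣ d ∧ ℓ ≠ 2
  · obtain ⟨ℓ, hℓp, ⟨e, rfl⟩, hℓ2⟩ := hℓ
    have : Fact ℓ.Prime := ⟨hℓp⟩
    have hℓe : ℓ.Coprime e := Nat.coprime_of_squarefree_mul hd
    have he0 : e ≠ 0 := by rintro rfl; simp at hd0
    have hℓodd : Odd ℓ := hℓp.odd_of_ne_two hℓ2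
    obtain ⟨k, s, hs, hbs⟩ := Nat.exists_eq_pow_mul_and_not_dvd hb0 ℓ hℓp.ne_one
    obtain ⟨u, hu⟩ := FiniteField.exists_nonsquare (F := ZMod ℓ)
      (by rwa [ZMod.ringChar_zmod_n])
    have hcop : (4 * e * s).Coprime ℓ := by
      refine Nat.Coprime.mul_left (Nat.Coprime.mul_left ?_ hℓe.symm)
        ((Nat.Prime.coprime_iff_not_dvd hℓp).mpr hs).symm
      exact Nat.Coprime.pow_left 2 (Nat.coprime_two_left.mpr hℓodd)
    obtain ⟨n, hn1, hn2⟩ := Nat.chineseRemainder hcop 1 u.val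
    have hn4 : n % 4 = 1 := hn1.of_dvd ⟨e * s, by ring⟩
    have hnodd : Odd n := Nat.odd_iff.mpr (by omega)
    have hnu : (n : ZMod ℓ) = u := by
      rw [(ZMod.natCast_eq_natCast_iff _ _ _).mpr hn2, ZMod.natCast_zmod_val]
    have hJℓ : J(n | ℓ) = -1 := by
      rw [ZMod.nonsquare_iff_jacobiSym_eq_neg_one]
      simpa [hnu] using hu
    refine ⟨n, hnodd, ?_, ?_⟩
    · rw [hbs]
      refine Nat.Coprime.mul_left (Nat.Coprime.pow_left k ?_)
        (coprime_of_modEq_one hn1 (Dvd.intro_left _ rfl))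
      rw [Nat.Prime.coprime_iff_not_dvd hℓp, ← ZMod.natCast_eq_zero_iff, hnu]
      rintro rfl
      exact hu (by simp)
    · have h1 : J(σ * e | n) = 1 := by
        rw [jacobiSym.mod_right _ hnodd, Int.natAbs_mul, hσabs, Int.natAbs_natCast, one_mul,
          (hn1.of_dvd ⟨s, by ring⟩ : n % (4 * e) = 1 % (4 * e)), Nat.mod_eq_of_lt (by omega),
          jacobiSym.one_right]
      rw [show (σ * ((ℓ * e : ℕ) : ℤ)) = (σ * e) * (ℓ : ℤ) by push_cast; ring,
        jacobiSym.mul_left, h1, jacobiSym.quadratic_reciprocity_one_mod_four' hℓodd hn4, hJℓ]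
      rfl
  · push Not at hℓ
    have hd12 : d = 1 ∨ d = 2 := by
      by_cases h1 : d = 1
      · exact Or.inl h1
      obtain ⟨q, hq, hqd⟩ := Nat.exists_prime_and_dvd h1
      obtain rfl := hℓ q hq hqd
      obtain ⟨e, rfl⟩ := hqd
      by_cases he : e = 1
      · exact Or.inr (by rw [he])
      obtain ⟨q', hq', hqe⟩ := Nat.exists_prime_and_dvd he
      obtain rfl := hℓ q' hq' (hqe.mul_left 2)
      exact absurd (hd 2 (Nat.mul_dvd_mul_left 2 hqe)) (by decide)
    obtain ⟨k, s, hs, hbs⟩ := Nat.exists_eq_pow_mul_and_not_dvd hb0 2 (by norm_num)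
    have hsodd : Odd s := Nat.not_even_iff_odd.mp fun h ↦ hs h.two_dvd
    have hcop : (8 : ℕ).Coprime s := Nat.Coprime.pow_left 3 (Nat.coprime_two_left.mpr hsodd)
    have main : ∀ c : ℕ, Odd c → (∀ n : ℕ, n % 8 = c % 8 → Odd n → J(σ * d | n) = -1) →
        ∃ n : ℕ, Odd n ∧ b.Coprime n ∧ J(σ * d | n) = -1 := by
      intro c hc hJ
      obtain ⟨n, hn1, hn2⟩ := Nat.chineseRemainder hcop c 1
      have hn1' : n % 8 = c % 8 := hn1
      have hnodd : Odd n := by rw [Nat.odd_iff] at hc ⊢; omega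
      refine ⟨n, hnodd, ?_, hJ n hn1 hnodd⟩
      rw [hbs]
      exact Nat.Coprime.mul_left (Nat.Coprime.pow_left k (Nat.coprime_two_left.mpr hnodd))
        (coprime_of_modEq_one hn2 dvd_rfl)
    rcases hσ with rfl | rfl <;> rcases hd12 with rfl | rfl
    · exact absurd ⟨(b : ℤ), by rw [hDσ]; push_cast; ring⟩ hD
    · refine main 3 (by decide) fun n hn hnodd ↦ ?_
      rw [jacobiSym.mod_right _ hnodd]
      norm_num [hn]
    · refine main 3 (by decide) fun n hn hnodd ↦ ?_
      rw [jacobiSym.mod_right _ hnodd]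
      have : n % 4 = 3 := by omega
      norm_num [this]
    · refine main 5 (by decide) fun n hn hnodd ↦ ?_
      rw [jacobiSym.mod_right _ hnodd]
      norm_num [hn]

/-- For a nonsquare `D` there is a nontrivial quadratic Dirichlet character that takes the value
`-1` only at primes modulo which `D` is a nonsquare. -/
lemma exists_quadratic_dirichletCharacter {D : ℤ} (hD : ¬IsSquare D) :
    ∃ q : ℕ, q ≠ 0 ∧ ∃ χ : DirichletCharacter ℂ q, χ ≠ 1 ∧
      (∀ n : ℕ, n.Coprime q → χ n = 1 ∨ χ n = -1) ∧
      ∀ p : ℕ, p.Prime → χ p = -1 → ¬IsSquare (D : ZMod p) := by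
  have hD0 : D ≠ 0 := by rintro rfl; exact hD (by simp)
  set q := 4 * D.natAbs with hq
  have hq0 : q ≠ 0 := by omega
  have : NeZero q := ⟨hq0⟩
  have odd_of : ∀ n : ℕ, n.Coprime q → Odd n := fun n hn ↦
    Nat.coprime_two_right.mp (hn.coprime_dvd_right ⟨2 * D.natAbs, by omega⟩)
  have hJmod : ∀ n : ℕ, n.Coprime q → J(D | n % q) = J(D | n) := fun n hn ↦
    (jacobiSym.mod_right D (odd_of n hn)).symm
  have hJ1 : ∀ n : ℕ, n.Coprime q → J(D | n) = 1 ∨ J(D | n) = -1 := fun n hn ↦ by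
    refine jacobiSym.eq_one_or_neg_one ?_
    have : D.natAbs.Coprime n := (hn.coprime_dvd_right ⟨4, by omega⟩).symm
    simpa [Int.gcd] using this
  have hcopval : ∀ x : ZMod q, IsUnit x → x.val.Coprime q := by
    rintro _ ⟨u, rfl⟩
    exact ZMod.val_coe_unit_coprime u
  classical
  let χ : DirichletCharacter ℂ q :=
    { toFun := fun x ↦ if IsUnit x then (J(D | x.val) : ℂ) else 0
      map_one' := by
        have : J(D | (1 : ZMod q).val) = 1 := by
          rw [ZMod.val_one_eq_one_mod, hJmod 1 (Nat.coprime_one_left q), jacobiSym.one_right]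
        simp [this]
      map_mul' := by
        intro x y
        by_cases hx : IsUnit x
        · by_cases hy : IsUnit y
          · have hcx := hcopval x hx
            have hcy := hcopval y hy
            rw [if_pos hx, if_pos hy, if_pos (hx.mul hy), ZMod.val_mul,
              hJmod _ (hcx.mul_left hcy),
              jacobiSym.mul_right' _ (odd_of _ hcx).pos.ne' (odd_of _ hcy).pos.ne']
            push_cast
            ring
          · rw [if_neg hy, if_neg fun h ↦ hy (isUnit_of_mul_isUnit_right h), mul_zero]
        · rw [if_neg hx, if_neg fun h ↦ hx (isUnit_of_mul_isUnit_left h), zero_mul]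
      map_nonunit' := fun x hx ↦ if_neg hx }
  have hχ : ∀ n : ℕ, n.Coprime q → χ n = (J(D | n) : ℂ) := by
    intro n hn
    change (if IsUnit (n : ZMod q) then (J(D | (n : ZMod q).val) : ℂ) else 0) = _
    rw [if_pos ((ZMod.isUnit_iff_coprime n q).mpr hn), ZMod.val_natCast, hJmod n hn]
  refine ⟨q, hq0, χ, ?_, ?_, ?_⟩
  · obtain ⟨n, hn, hJ⟩ := exists_jacobiSym_eq_neg_one hD
    have hcop : n.Coprime q := by
      refine Nat.Coprime.mul_right ?_ ?_
      · exact Nat.Coprime.pow_right 2 (Nat.coprime_two_right.mpr hn)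
      · by_contra hc
        have : NeZero n := ⟨hn.pos.ne'⟩
        have := jacobiSym.eq_zero_iff_not_coprime (a := D) (b := n)
        rw [hJ] at this
        have h2 := this.mpr (by rw [Int.gcd]; simpa [Nat.Coprime, Nat.gcd_comm] using hc)
        omega
    intro h
    have h1 := hχ n hcop
    rw [h, MulChar.one_apply ((ZMod.isUnit_iff_coprime n q).mpr hcop), hJ] at h1
    norm_num at h1
  · intro n hn
    rw [hχ n hn]
    rcases hJ1 n hn with h | h <;> simp [h]
  · intro p hp h
    have : Fact p.Prime := ⟨hp⟩
    rw [← ZMod.nonsquare_iff_jacobiSym_eq_neg_one]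
    have hcop : p.Coprime q := by
      rw [← ZMod.isUnit_iff_coprime]
      by_contra hc
      rw [χ.map_nonunit hc] at h
      norm_num at h
    rw [hχ p hcop] at h
    exact_mod_cast h

/-- The convergence test of Dirichlet in quantitative form. -/
theorem norm_sum_Ioc_mul_le {f : ℕ → ℂ} {g : ℕ → ℝ} {B : ℝ} {a : ℕ}
    (hf : ∀ n, ‖∑ i ∈ Ioc 0 n, f i‖ ≤ B) (hg : ∀ n, a < n → g (n + 1) ≤ g n)
    (hg0 : ∀ n, a < n → 0 ≤ g n) {b : ℕ} (hab : a ≤ b) :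
    ‖∑ i ∈ Ioc a b, f i * g i‖ ≤ 2 * B * g (a + 1) := by
  set F : ℕ → ℂ := fun n ↦ ∑ i ∈ Ioc 0 n, f i with hF
  have habel : ∑ i ∈ Ioc a b, f i * g i =
      F b * g (b + 1) - F a * g (a + 1) + ∑ i ∈ Ioc a b, F i * ((g i - g (i + 1) : ℝ) : ℂ) := by
    induction b, hab using Nat.le_induction with
    | base => simp
    | succ b hab ih =>
      have hs : F (b + 1) = F b + f (b + 1) := sum_Ioc_succ_top (Nat.zero_le b) f
      rw [sum_Ioc_succ_top hab, sum_Ioc_succ_top hab, ih, hs]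
      push_cast
      ring
  have htel : ∑ i ∈ Ioc a b, B * (g i - g (i + 1)) = B * (g (a + 1) - g (b + 1)) := by
    clear habel
    induction b, hab using Nat.le_induction with
    | base => simp
    | succ b hab ih =>
      rw [sum_Ioc_succ_top hab, ih]
      ring
  have h1 : ‖F b * g (b + 1)‖ ≤ B * g (b + 1) := by
    rw [norm_mul, Complex.norm_real, Real.norm_of_nonneg (hg0 _ (by omega))]
    exact mul_le_mul_of_nonneg_right (hf b) (hg0 _ (by omega))
  have h2 : ‖F a * g (a + 1)‖ ≤ B * g (a + 1) := by
    rw [norm_mul, Complex.norm_real, Real.norm_of_nonneg (hg0 _ (by omega))]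
    exact mul_le_mul_of_nonneg_right (hf a) (hg0 _ (by omega))
  have h3 : ‖∑ i ∈ Ioc a b, F i * ((g i - g (i + 1) : ℝ) : ℂ)‖ ≤ B * (g (a + 1) - g (b + 1)) := by
    rw [← htel]
    refine norm_sum_le_of_le _ fun i hi ↦ ?_
    have := sub_nonneg.mpr (hg i (mem_Ioc.mp hi).1)
    rw [norm_mul, Complex.norm_real, Real.norm_of_nonneg this]
    exact mul_le_mul_of_nonneg_right (hf i) this
  rw [habel]
  calc _ ≤ ‖F b * g (b + 1)‖ + ‖F a * g (a + 1)‖ +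
        ‖∑ i ∈ Ioc a b, F i * ((g i - g (i + 1) : ℝ) : ℂ)‖ :=
        (norm_add_le _ _).trans (add_le_add_left (norm_sub_le _ _) _)
    _ ≤ _ := by linarith

theorem natCast_div_le_add_one (m n : ℕ) : (m : ℝ) / n ≤ (m / n : ℕ) + 1 := by
  rw [← Nat.floor_div_eq_div (K := ℝ)]
  exact (Nat.lt_floor_add_one _).le

namespace DirichletCharacter

variable {q : ℕ} [NeZero q] {χ : DirichletCharacter ℂ q}

theorem norm_sum_Ioc_le (hχ : χ ≠ 1) (n : ℕ) : ‖∑ i ∈ Ioc 0 n, χ i‖ ≤ q := by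
  induction n using Nat.strong_induction_on with
  | _ n ih =>
    rcases le_or_gt n q with h | h
    · calc _ ≤ ∑ i ∈ Ioc 0 n, (1 : ℝ) := norm_sum_le_of_le _ fun i _ ↦ χ.norm_le_one _
        _ ≤ q := by simpa using h
    · have hq : 0 < q := Nat.pos_of_neZero q
      have hperiod : ∑ i ∈ Ioc (n - q) n, χ i = 0 := by
        rw [← MulChar.sum_eq_zero_of_ne_one hχ]
        refine sum_bij (fun i _ ↦ (i : ZMod q)) (fun _ _ ↦ mem_univ _) ?_ ?_ (fun _ _ ↦ rfl)
        · intro i hi j hj hij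
          rw [ZMod.natCast_eq_natCast_iff] at hij
          rw [mem_Ioc] at hi hj
          rcases le_total i j with hle | hle
          · have := Nat.eq_zero_of_dvd_of_lt ((Nat.modEq_iff_dvd' hle).mp hij) (by omega)
            omega
          · have := Nat.eq_zero_of_dvd_of_lt ((Nat.modEq_iff_dvd' hle).mp hij.symm) (by omega)
            omega
        · intro x _
          refine ⟨n - ((n : ZMod q) - x).val, ?_, ?_⟩
          · have := ZMod.val_lt ((n : ZMod q) - x)
            rw [mem_Ioc]
            omega
          · have := ZMod.val_lt ((n : ZMod q) - x)
            rw [Nat.cast_sub (by omega), ZMod.natCast_zmod_val]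
            ring
      have hsplit := sum_Ioc_consecutive (fun i ↦ χ i) (Nat.zero_le (n - q)) (Nat.sub_le n q)
      rw [← hsplit, hperiod, add_zero]
      exact ih _ (by omega)

theorem norm_LFunction_sub_sum_le_of_one_lt (hχ : χ ≠ 1) (a : ℕ) {s : ℝ} (hs : 1 < s) :
    ‖LFunction χ s - ∑ n ∈ Ioc 0 a, χ n * ((n : ℝ) ^ (-s) : ℝ)‖ ≤ 2 * q * (a + 1 : ℝ) ^ (-s) := by
  have hterm : ∀ n, LSeries.term (fun n ↦ χ n) s n =
      if n = 0 then 0 else χ n * ((n : ℝ) ^ (-s) : ℝ) := by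
    intro n
    rw [LSeries.term_def]
    split_ifs
    · rfl
    · rw [Complex.ofReal_cpow (Nat.cast_nonneg n), div_eq_mul_inv, Complex.ofReal_neg,
        Complex.cpow_neg, Complex.ofReal_natCast]
  have hsum := (LSeriesSummable_of_one_lt_re χ (s := s) (by simpa using hs)).hasSum.tendsto_sum_nat
  rw [show (∑' n, LSeries.term (fun n ↦ χ n) s n) = LFunction χ s from
    (LFunction_eq_LSeries χ (by simpa using hs)).symm] at hsum
  have hpart : ∀ N, ∑ n ∈ range (N + 1), LSeries.term (fun n ↦ χ n) s n =
      ∑ n ∈ Ioc 0 N, χ n * ((n : ℝ) ^ (-s) : ℝ) := by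
    intro N
    rw [range_eq_Ico, sum_eq_sum_Ico_succ_bot (by omega), hterm, if_pos rfl, zero_add]
    refine sum_congr (by ext; simp; omega) fun n hn ↦ ?_
    rw [hterm, if_neg (by have := mem_Ioc.mp hn; omega)]
  have hlim := ((hsum.comp (Filter.tendsto_add_atTop_nat 1)).sub_const
    (∑ n ∈ Ioc 0 a, χ n * ((n : ℝ) ^ (-s) : ℝ))).norm
  refine le_of_tendsto hlim ?_
  filter_upwards [Filter.eventually_ge_atTop a] with N hN
  simp only [Function.comp_apply, hpart]
  rw [← sum_Ioc_consecutive _ (Nat.zero_le a) hN, add_sub_cancel_left]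
  have := norm_sum_Ioc_mul_le (g := fun n ↦ (n : ℝ) ^ (-s)) (a := a) (norm_sum_Ioc_le hχ)
    (fun n hn ↦ Real.rpow_le_rpow_of_nonpos
      (by exact_mod_cast (by omega : 0 < n)) (by simp) (by linarith))
    (fun n hn ↦ by positivity) hN
  simpa using this

/-- The partial sums of `L(1, χ)` converge at rate `O(1 / a)`. -/
theorem norm_LFunction_one_sub_sum_le (hχ : χ ≠ 1) (a : ℕ) :
    ‖LFunction χ 1 - ∑ n ∈ Ioc 0 a, χ n / n‖ ≤ 2 * q / (a + 1) := by
  have hL : Continuous fun s : ℝ ↦ LFunction χ s :=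
    (differentiable_LFunction hχ).continuous.comp Complex.continuous_ofReal
  have hc : Continuous fun s : ℝ ↦ ∑ n ∈ Ioc 0 a, χ n * ((n : ℝ) ^ (-s) : ℝ) := by
    refine continuous_finsetSum _ fun n hn ↦ continuous_const.mul
      (Complex.continuous_ofReal.comp ?_)
    exact (Real.continuous_const_rpow (by have := (mem_Ioc.mp hn).1; positivity)).comp
      continuous_neg
  have hr : Continuous fun s : ℝ ↦ 2 * (q : ℝ) * (a + 1 : ℝ) ^ (-s) :=
    continuous_const.mul ((Real.continuous_const_rpow (by positivity)).comp continuous_neg)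
  have h := le_of_tendsto_of_tendsto
    ((hL.sub hc).norm.tendsto 1 |>.mono_left (nhdsWithin_le_nhds (s := Set.Ioi 1)))
    (hr.tendsto 1 |>.mono_left nhdsWithin_le_nhds)
    (by
      filter_upwards [self_mem_nhdsWithin] with s hs
      exact norm_LFunction_sub_sum_le_of_one_lt hχ a hs)
  simpa [Real.rpow_neg_one, div_eq_mul_inv] using h

theorem exists_norm_sum_log_div_le (hχ : χ ≠ 1) :
    ∃ C : ℝ, ∀ N : ℕ, ‖∑ n ∈ Ioc 0 N, χ n * (Real.log n / n : ℝ)‖ ≤ C := by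
  refine ⟨‖∑ n ∈ Ioc (0 : ℕ) 2, χ n * (Real.log n / n : ℝ)‖ + 2 * q * (Real.log 3 / 3), fun N ↦ ?_⟩
  have hlog3 : 0 ≤ Real.log 3 := Real.log_nonneg (by norm_num)
  rcases le_or_gt 2 N with hN | hN
  · rw [← sum_Ioc_consecutive _ (Nat.zero_le 2) hN]
    refine (norm_add_le _ _).trans (add_le_add_right ?_ _)
    have he : Real.exp 1 ≤ 3 := Real.exp_one_lt_three.le
    have := norm_sum_Ioc_mul_le (g := fun n ↦ Real.log n / n) (a := 2) (norm_sum_Ioc_le hχ)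
      (fun n hn ↦ Real.log_div_self_antitoneOn
        (he.trans (by exact_mod_cast hn)) (he.trans (by exact_mod_cast (by omega : 3 ≤ n + 1)))
        (by simp)) (fun n hn ↦ div_nonneg (Real.log_natCast_nonneg n) n.cast_nonneg) hN
    norm_num at this ⊢
    exact this
  · have : ∑ n ∈ Ioc 0 N, χ n * (Real.log n / n : ℝ) = 0 := by interval_cases N <;> simp
    rw [this, norm_zero]
    positivity

/-- The theorem of Mertens for a nontrivial character: `∑ n ≤ N, χ n * Λ n / n` is bounded. -/
theorem exists_norm_sum_vonMangoldt_div_le (hχ : χ ≠ 1) :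
    ∃ C : ℝ, ∀ N : ℕ, ‖∑ n ∈ Ioc 0 N, χ n * (vonMangoldt n / n : ℝ)‖ ≤ C := by
  obtain ⟨C, hC⟩ := exists_norm_sum_log_div_le hχ
  have hL0 : 0 < ‖LFunction χ 1‖ := norm_pos_iff.mpr (LFunction_apply_one_ne_zero hχ)
  refine ⟨(C + 2 * q * (Real.log 4 + 4)) / ‖LFunction χ 1‖, fun N ↦ ?_⟩
  rw [le_div_iff₀ hL0, mul_comm, ← norm_mul]
  let f : ArithmeticFunction ℂ := ⟨fun n ↦ χ n * (vonMangoldt n / n : ℝ), by simp⟩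
  let g : ArithmeticFunction ℂ := ⟨fun n ↦ χ n / n, by simp⟩
  have hfg : ∀ n, (f * g) n = χ n * (Real.log n / n : ℝ) := by
    intro n
    rw [ArithmeticFunction.mul_apply, ← ArithmeticFunction.vonMangoldt_sum,
      ← Nat.sum_divisorsAntidiagonal (fun d _ ↦ vonMangoldt d), sum_div, Complex.ofReal_sum,
      mul_sum]
    refine sum_congr rfl fun x hx ↦ ?_
    rw [← (Nat.mem_divisorsAntidiagonal.mp hx).1]
    simp only [f, g, ArithmeticFunction.coe_mk, Nat.cast_mul, map_mul]
    push_cast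
    ring
  have hconv := ArithmeticFunction.sum_Ioc_mul_eq_sum_sum f g N
  simp only [hfg] at hconv
  have hkey : LFunction χ 1 * ∑ n ∈ Ioc 0 N, f n = ∑ n ∈ Ioc 0 N, χ n * (Real.log n / n : ℝ) +
      ∑ d ∈ Ioc 0 N, f d * (LFunction χ 1 - ∑ m ∈ Ioc 0 (N / d), g m) := by
    rw [hconv, ← sum_add_distrib, mul_sum]
    exact sum_congr rfl fun _ _ ↦ by ring
  change ‖LFunction χ 1 * ∑ n ∈ Ioc 0 N, f n‖ ≤ _
  rw [hkey]
  refine (norm_add_le _ _).trans (add_le_add (hC N) ?_)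
  rcases N.eq_zero_or_pos with rfl | hN
  · simp
    positivity
  have hN' : (0 : ℝ) < N := by exact_mod_cast hN
  have hpsi := Chebyshev.psi_le_const_mul_self hN'.le
  rw [Chebyshev.psi, Nat.floor_natCast] at hpsi
  calc _ ≤ ∑ d ∈ Ioc 0 N, 2 * q / N * vonMangoldt d := by
        refine norm_sum_le_of_le _ fun d hd ↦ ?_
        have hd0 : (0 : ℝ) < d := by exact_mod_cast (mem_Ioc.mp hd).1
        have hΛ : 0 ≤ vonMangoldt d := ArithmeticFunction.vonMangoldt_nonneg
        have hfd : ‖f d‖ ≤ vonMangoldt d / d := by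
          simp only [f, ArithmeticFunction.coe_mk, norm_mul, Complex.norm_real]
          rw [Real.norm_of_nonneg (by positivity)]
          exact mul_le_of_le_one_left (by positivity) (χ.norm_le_one _)
        have hgd : ‖LFunction χ 1 - ∑ m ∈ Ioc 0 (N / d), g m‖ ≤ 2 * q * (d / N) := by
          refine (norm_LFunction_one_sub_sum_le hχ (N / d)).trans ?_
          rw [div_eq_mul_inv]
          refine mul_le_mul_of_nonneg_left ?_ (by positivity)
          rw [← inv_div]
          exact inv_anti₀ (by positivity) (natCast_div_le_add_one N d)
        rw [norm_mul]
        calc _ ≤ vonMangoldt d / d * (2 * q * (d / N)) := by gcongr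
          _ = _ := by field_simp
    _ = 2 * q * ((∑ d ∈ Ioc 0 N, vonMangoldt d) / N) := by rw [← mul_sum]; ring
    _ ≤ _ := by
        gcongr
        rwa [div_le_iff₀ hN']

end DirichletCharacter

/-- The first theorem of Mertens: `∑ d ≤ N, Λ d / d = log N + O(1)`. -/
theorem exists_abs_sum_vonMangoldt_div_sub_log_le :
    ∃ C : ℝ, ∀ N : ℕ, 0 < N → |∑ d ∈ Ioc 0 N, vonMangoldt d / d - Real.log N| ≤ C := by
  refine ⟨Real.log 4 + 4, fun N hN ↦ ?_⟩
  have hN' : (0 : ℝ) < N := by exact_mod_cast hN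
  have hpsi := Chebyshev.psi_le_const_mul_self hN'.le
  rw [Chebyshev.psi, Nat.floor_natCast] at hpsi
  have hlog4 : 0 ≤ Real.log 4 := Real.log_nonneg (by norm_num)
  have hfac : Real.log N.factorial = ∑ d ∈ Ioc 0 N, vonMangoldt d * (N / d : ℕ) := by
    rw [← ArithmeticFunction.sum_Ioc_mul_zeta_eq_sum, ArithmeticFunction.vonMangoldt_mul_zeta]
    clear hN hN' hpsi
    induction N with
    | zero => simp
    | succ n ih =>
      rw [sum_Ioc_succ_top n.zero_le, ← ih, Nat.factorial_succ, Nat.cast_mul,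
        Real.log_mul (by positivity) (by positivity), ArithmeticFunction.log_apply, add_comm]
  have hup : Real.log N.factorial ≤ N * Real.log N := by
    rw [← Real.log_pow]
    exact Real.log_le_log (by positivity) (by exact_mod_cast Nat.factorial_le_pow N)
  have hlow : N * Real.log N - N ≤ Real.log N.factorial := by
    have := Real.pow_div_factorial_le_exp (N : ℝ) hN'.le N
    have := Real.log_le_log (by positivity) this
    rw [Real.log_exp, Real.log_div (by positivity) (by positivity), Real.log_pow] at this
    linarith
  set S := ∑ d ∈ Ioc 0 N, vonMangoldt d / d with hS
  have h1 : Real.log N.factorial ≤ N * S := by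
    rw [hfac, hS, mul_sum]
    refine sum_le_sum fun d _ ↦ ?_
    calc _ ≤ vonMangoldt d * ((N : ℝ) / d) :=
          mul_le_mul_of_nonneg_left Nat.cast_div_le ArithmeticFunction.vonMangoldt_nonneg
      _ = _ := by ring
  have h2 : N * S ≤ Real.log N.factorial + ∑ d ∈ Ioc 0 N, vonMangoldt d := by
    rw [hfac, hS, mul_sum, ← sum_add_distrib]
    refine sum_le_sum fun d hd ↦ ?_
    calc _ = vonMangoldt d * ((N : ℝ) / d) := by ring
      _ ≤ vonMangoldt d * ((N / d : ℕ) + 1) :=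
          mul_le_mul_of_nonneg_left (natCast_div_le_add_one N d)
            ArithmeticFunction.vonMangoldt_nonneg
      _ = _ := by ring
  rw [abs_le]
  constructor
  · refine le_of_mul_le_mul_left ?_ hN'
    nlinarith
  · refine le_of_mul_le_mul_left ?_ hN'
    nlinarith

theorem exists_sum_vonMangoldt_div_not_prime_le :
    ∃ C : ℝ, ∀ s : Finset ℕ, ∑ d ∈ s with ¬ d.Prime, vonMangoldt d / d ≤ C := by
  have h := ArithmeticFunction.vonMangoldt.summable_residueClass_non_primes_div (q := 1) 0
  refine ⟨_, fun s ↦ le_trans ?_ (h.sum_le_tsum s fun n _ ↦ ?_)⟩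
  · rw [sum_filter]
    refine (sum_congr rfl fun n _ ↦ ?_).le
    simp only [ArithmeticFunction.vonMangoldt.residueClass]
    have : (n : ZMod 1) = 0 := Subsingleton.elim _ _
    split_ifs <;> simp_all
  · have := ArithmeticFunction.vonMangoldt.residueClass_nonneg (q := 1) 0 n
    split_ifs <;> positivity

open Classical in
/-- For a nonsquare `D`, every window `(N, K * N]` with `N` large contains many primes modulo which
`D` is a nonsquare. -/
theorem exists_one_le_sum_log_div_nonsquare {D : ℤ} (hD : ¬IsSquare D) :
    ∃ K N₀ : ℕ, 2 ≤ K ∧ ∀ N, N₀ ≤ N →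
      1 ≤ ∑ p ∈ Ioc N (K * N) with p.Prime ∧ ¬IsSquare (D : ZMod p), Real.log p / p := by
  obtain ⟨q, hq, χ, hχ, hχval, hχsq⟩ := exists_quadratic_dirichletCharacter hD
  have : NeZero q := ⟨hq⟩
  obtain ⟨C₁, hC₁⟩ := DirichletCharacter.exists_norm_sum_vonMangoldt_div_le hχ
  obtain ⟨C₂, hC₂⟩ := exists_abs_sum_vonMangoldt_div_sub_log_le
  obtain ⟨C₃, hC₃⟩ := exists_sum_vonMangoldt_div_not_prime_le
  set w : ℕ → ℝ := fun d ↦ (1 - (χ d).re) * (vonMangoldt d / d) with hw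
  have hT : ∀ N : ℕ, 0 < N → |∑ d ∈ Ioc 0 N, w d - Real.log N| ≤ C₁ + C₂ := by
    intro N hN
    have hre : ∑ d ∈ Ioc 0 N, w d - Real.log N =
        (∑ d ∈ Ioc 0 N, vonMangoldt d / d - Real.log N) -
          (∑ d ∈ Ioc 0 N, χ d * (vonMangoldt d / d : ℝ)).re := by
      rw [Complex.re_sum, sub_right_comm, ← sum_sub_distrib]
      congr 1
      refine sum_congr rfl fun d _ ↦ ?_
      rw [Complex.re_mul_ofReal, hw]
      ring
    rw [hre, add_comm]
    exact (abs_sub _ _).trans (add_le_add (hC₂ N hN) ((Complex.abs_re_le_norm _).trans (hC₁ N)))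
  have hwle : ∀ d, w d ≤ 2 * (vonMangoldt d / d) := by
    intro d
    have h1 := (Complex.abs_re_le_norm _).trans (χ.norm_le_one d)
    have h2 : 0 ≤ vonMangoldt d := ArithmeticFunction.vonMangoldt_nonneg
    exact mul_le_mul_of_nonneg_right (by linarith [neg_le_of_abs_le h1]) (by positivity)
  obtain ⟨K, hK⟩ := exists_nat_ge (Real.exp (2 * (C₁ + C₂) + 2 * C₃ + 2))
  refine ⟨max K 2, q + 1, le_max_right _ _, fun N hN ↦ ?_⟩
  have hN0 : 0 < N := by omega
  set L := max K 2
  have hL2 : 2 ≤ L := le_max_right _ _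
  have hlogL : 2 * (C₁ + C₂) + 2 * C₃ + 2 ≤ Real.log L := by
    rw [Real.le_log_iff_exp_le (by positivity)]
    exact hK.trans (by exact_mod_cast le_max_left _ _)
  have hwin : Real.log L - 2 * (C₁ + C₂) ≤ ∑ d ∈ Ioc N (L * N), w d := by
    have h1 := abs_le.mp (hT N hN0)
    have h2 := abs_le.mp (hT (L * N) (by positivity))
    rw [← sum_Ioc_consecutive _ (Nat.zero_le N) (Nat.le_mul_of_pos_left N (by omega)),
      Nat.cast_mul, Real.log_mul (by positivity) (by positivity)] at h2
    linarith
  have hprime : ∑ d ∈ Ioc N (L * N) with d.Prime, w d ≤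
      2 * ∑ p ∈ Ioc N (L * N) with p.Prime ∧ ¬IsSquare (D : ZMod p), Real.log p / p := by
    rw [mul_sum, ← filter_filter, sum_filter (fun p ↦ ¬IsSquare (D : ZMod p))]
    refine sum_le_sum fun p hp ↦ ?_
    obtain ⟨hp, hpp⟩ := mem_filter.mp hp
    have hpq : p.Coprime q := Nat.coprime_of_lt_prime hq (by have := mem_Ioc.mp hp; omega) hpp
    split_ifs with hsq
    · rcases hχval p hpq with h | h
      · simp [hw, h]
      · exact absurd hsq (hχsq p hpp h)
    · exact (hwle p).trans_eq (by rw [ArithmeticFunction.vonMangoldt_apply_prime hpp])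
  have hnot : ∑ d ∈ Ioc N (L * N) with ¬ d.Prime, w d ≤ 2 * C₃ := by
    refine (sum_le_sum fun d _ ↦ hwle d).trans ?_
    rw [← mul_sum]
    exact mul_le_mul_of_nonneg_left (hC₃ _) (by norm_num)
  rw [← sum_filter_add_sum_filter_not _ (fun d : ℕ ↦ d.Prime)] at hwin
  linarith

section Windows

variable {G : ℕ → Prop} [DecidablePred G] {K N₀ : ℕ}

theorem le_card_of_one_le_sum_log_div {N : ℕ} (hN : 0 < N) (hK : 2 ≤ K)
    (h : 1 ≤ ∑ p ∈ Ioc N (K * N) with G p, Real.log p / p) :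
    N / Real.log (K * N : ℕ) ≤ #{p ∈ Ioc N (K * N) | G p} := by
  have hN' : (0 : ℝ) < N := by exact_mod_cast hN
  have hlog : 0 < Real.log (K * N : ℕ) := Real.log_pos (by exact_mod_cast (by nlinarith))
  rw [div_le_iff₀ hlog]
  calc (N : ℝ) ≤ N * ∑ p ∈ Ioc N (K * N) with G p, Real.log p / p :=
        le_mul_of_one_le_right hN'.le h
    _ ≤ N * ∑ p ∈ Ioc N (K * N) with G p, Real.log (K * N : ℕ) / N := by
        gcongr with p hp
        · have := mem_Ioc.mp (mem_filter.mp hp).1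
          exact_mod_cast (by omega : 0 < p)
        · exact (mem_Ioc.mp (mem_filter.mp hp).1).2
        · exact (mem_Ioc.mp (mem_filter.mp hp).1).1.le
    _ = _ := by
        rw [sum_const, nsmul_eq_mul]
        field_simp

theorem one_div_log_le_sum_one_div {N : ℕ} (hN : 0 < N) (hK : 2 ≤ K)
    (h : 1 ≤ ∑ p ∈ Ioc N (K * N) with G p, Real.log p / p) :
    1 / Real.log (K * N : ℕ) ≤ ∑ p ∈ Ioc N (K * N) with G p, (1 / p : ℝ) := by
  have hlog : 0 < Real.log (K * N : ℕ) := Real.log_pos (by exact_mod_cast (by nlinarith))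
  rw [div_le_iff₀ hlog, sum_mul]
  refine h.trans (sum_le_sum fun p hp ↦ ?_)
  have hp := mem_Ioc.mp (mem_filter.mp hp).1
  have hp0 : (0 : ℝ) < p := by exact_mod_cast (by omega : 0 < p)
  rw [one_div_mul_eq_div]
  gcongr
  exact hp.2

theorem exists_le_sum_one_div (hK : 2 ≤ K)
    (h : ∀ N, N₀ ≤ N → 1 ≤ ∑ p ∈ Ioc N (K * N) with G p, Real.log p / p) (B : ℝ) (m : ℕ) :
    ∃ R : Finset ℕ, (∀ r ∈ R, m < r ∧ G r) ∧ B ≤ ∑ r ∈ R, (1 / r : ℝ) := by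
  have hlogK : 0 < Real.log K := Real.log_pos (by exact_mod_cast hK)
  set a := N₀ + m with ha
  have hmain : ∀ b, a ≤ b → (∑ k ∈ Ico a b, (1 / (k + 1) : ℝ)) / Real.log K ≤
      ∑ r ∈ Ioc (K ^ a) (K ^ b) with G r, (1 / r : ℝ) := by
    intro b hab
    induction b, hab using Nat.le_induction with
    | base => simp
    | succ b hab ih =>
      have hb : N₀ ≤ K ^ b := by
        have := (Nat.lt_pow_self (n := b) (by omega : 1 < K))
        omega
      have h1 := one_div_log_le_sum_one_div (by positivity) hK (h _ hb)
      rw [sum_Ico_succ_top hab, add_div, sum_filter,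
        ← sum_Ioc_consecutive _ (Nat.pow_le_pow_right (by omega) hab)
          (Nat.pow_le_pow_right (by omega) b.le_succ), ← sum_filter, ← sum_filter]
      refine add_le_add ih ?_
      rw [← Nat.pow_succ'] at h1
      refine le_trans (le_of_eq ?_) h1
      rw [Nat.cast_pow, Real.log_pow, div_div]
      push_cast
      rfl
  have hdiv := Real.tendsto_sum_range_one_div_nat_succ_atTop
  obtain ⟨b, hb, hab⟩ := ((hdiv.eventually_ge_atTop
    (∑ k ∈ range a, (1 / (k + 1) : ℝ) + B * Real.log K)).and
      (Filter.eventually_ge_atTop a)).exists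
  refine ⟨{r ∈ Ioc (K ^ a) (K ^ b) | G r}, fun r hr ↦ ?_, le_trans ?_ (hmain b hab)⟩
  · obtain ⟨hr, hG⟩ := mem_filter.mp hr
    have := (Nat.lt_pow_self (n := a) (by omega : 1 < K))
    exact ⟨by have := mem_Ioc.mp hr; omega, hG⟩
  · rw [le_div_iff₀ hlogK]
    rw [← sum_range_add_sum_Ico _ hab] at hb
    linarith

/-- If the windows `(N, K * N]` contain many `p` with `G p`, then there are at least `Q / log Q`
pairs `(p, r)` of such numbers with `m < r < p` and `p * r ≤ Q`. -/
theorem exists_card_pairs_ge (hK : 2 ≤ K)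
    (h : ∀ N, N₀ ≤ N → 1 ≤ ∑ p ∈ Ioc N (K * N) with G p, Real.log p / p) (m : ℕ) :
    ∃ Q₀ : ℕ, ∀ Q, Q₀ ≤ Q → ∃ P : Finset (ℕ × ℕ),
      (∀ x ∈ P, G x.1 ∧ G x.2 ∧ m < x.2 ∧ x.2 < x.1 ∧ x.1 * x.2 ≤ Q) ∧
        Q / Real.log Q ≤ #P := by
  obtain ⟨R, hR, hsum⟩ := exists_le_sum_one_div hK h (2 * K) m
  obtain ⟨M, hM⟩ := R.exists_nat_subset_range
  refine ⟨(N₀ + M + 2) * (M * K) + 2, fun Q hQ ↦ ?_⟩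
  have hlogQ : 0 < Real.log Q := Real.log_pos (by exact_mod_cast (by omega : 1 < Q))
  let s : ℕ → Finset ℕ := fun r ↦ {p ∈ Ioc (Q / (r * K)) (K * (Q / (r * K))) | G p}
  have hlarge : ∀ r ∈ R, 0 < r ∧ r ≤ M ∧ N₀ + M + 2 ≤ Q / (r * K) := by
    intro r hr
    have hr0 : 0 < r := by have := hR r hr; omega
    have hrM : r ≤ M := (mem_range.mp (hM hr)).le
    refine ⟨hr0, hrM, ?_⟩
    rw [Nat.le_div_iff_mul_le (by positivity)]
    calc _ ≤ (N₀ + M + 2) * (M * K) := by gcongr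
      _ ≤ Q := by omega
  have htop : ∀ r ∈ R, K * (Q / (r * K)) * r ≤ Q := by
    intro r _
    calc _ = (r * K) * (Q / (r * K)) := by ring
      _ ≤ Q := Nat.mul_div_le _ _
  have hcard : ∀ r ∈ R, Q / (2 * K * Real.log Q) * (1 / r : ℝ) ≤ #(s r) := by
    intro r hr
    obtain ⟨hr0, hrM, hbig⟩ := hlarge r hr
    have hpos : 0 < Q / (r * K) := by omega
    refine le_trans ?_ (le_card_of_one_le_sum_log_div hpos hK (h _ (by omega)))
    have hQr : K * (Q / (r * K)) ≤ Q := (Nat.le_mul_of_pos_right _ hr0).trans (htop r hr)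
    have hfl := natCast_div_le_add_one Q (r * K)
    have hone : (1 : ℝ) ≤ (Q / (r * K) : ℕ) := by exact_mod_cast hpos
    have hlogpos : 0 < Real.log (K * (Q / (r * K)) : ℕ) :=
      Real.log_pos (by exact_mod_cast (by nlinarith))
    have hr' : (0 : ℝ) < r := by exact_mod_cast hr0
    have hK' : (0 : ℝ) < K := by exact_mod_cast (by omega : 0 < K)
    calc Q / (2 * K * Real.log Q) * (1 / r : ℝ) = Q / (r * K : ℕ) / 2 / Real.log Q := by
          push_cast
          field_simp
      _ ≤ (Q / (r * K) : ℕ) / Real.log Q := by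
          gcongr
          linarith
      _ ≤ (Q / (r * K) : ℕ) / Real.log (K * (Q / (r * K)) : ℕ) := by
          gcongr
  refine ⟨R.biUnion fun r ↦ (s r).image fun p ↦ (p, r), fun x hx ↦ ?_, ?_⟩
  · simp only [mem_biUnion, mem_image] at hx
    obtain ⟨r, hr, p, hp, rfl⟩ := hx
    obtain ⟨hp, hGp⟩ := mem_filter.mp hp
    obtain ⟨hp1, hp2⟩ := mem_Ioc.mp hp
    obtain ⟨hr0, hrM, hbig⟩ := hlarge r hr
    exact ⟨hGp, (hR r hr).2, (hR r hr).1, by dsimp only; omega,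
      (Nat.mul_le_mul_right r hp2).trans (htop r hr)⟩
  · rw [card_biUnion]
    · have hK' : (0 : ℝ) < K := by exact_mod_cast (by omega : 0 < K)
      push_cast
      calc (Q : ℝ) / Real.log Q = Q / (2 * K * Real.log Q) * (2 * K) := by field_simp
        _ ≤ Q / (2 * K * Real.log Q) * ∑ r ∈ R, (1 / r : ℝ) := by gcongr
        _ ≤ ∑ r ∈ R, (#(s r) : ℝ) := by
            rw [mul_sum]
            exact sum_le_sum hcard
        _ = _ := by
            refine sum_congr rfl fun r _ ↦ ?_
            rw [card_image_of_injective _ fun _ _ h ↦ (Prod.ext_iff.mp h).1]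
    · intro r _ r' _ hne
      simp only [disjoint_left, mem_image]
      rintro _ ⟨p, _, rfl⟩ ⟨p', _, h⟩
      exact hne (Prod.ext_iff.mp h).2.symm

end Windows

theorem card_image_cast_conic_le {p : ℕ} (hp : p.Prime) (hp19 : 19 ≤ p) {a : ℤ} (N τ : ℤ)
    (ha : ¬IsSquare ((-a : ℤ) : ZMod p)) {T : Finset ℤ}
    (hT : ∀ m ∈ T, ∃ n : ℤ, a * m ^ 2 + n ^ 2 = N) :
    3 * #((T.image (· - τ)).image (fun n : ℤ ↦ (n : ZMod p))) ≤ 2 * p := by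
  classical
  have : Fact p.Prime := ⟨hp⟩
  have hcard := card_conic_abscissae_le hp19 (a : ZMod p) N (by simpa using ha)
  refine le_trans (Nat.mul_le_mul_left 3 ?_) hcard
  refine le_trans (card_le_card ?_)
    (card_image_le (f := fun x : ZMod p ↦ x - (τ : ZMod p)))
  intro x hx
  simp only [mem_image, exists_exists_and_eq_and] at hx
  obtain ⟨m, hm, rfl⟩ := hx
  obtain ⟨n, hn⟩ := hT m hm
  refine mem_image.mpr ⟨(m : ZMod p), mem_filter.mpr ⟨mem_univ _, (n : ZMod p), ?_⟩,
    by push_cast; rfl⟩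
  exact_mod_cast congrArg (Int.cast : ℤ → ZMod p) hn

theorem finite_setOf_abs_sub_lt (M : ℝ) (τ : ℤ) : {m : ℤ | |(m : ℝ) - τ| < M}.Finite := by
  refine (Set.finite_Icc (τ - ⌈M⌉) (τ + ⌈M⌉)).subset fun m hm ↦ ?_
  have h := abs_lt.mp (show |(m : ℝ) - τ| < M from hm)
  have := Int.le_ceil M
  constructor
  · have : ((τ - ⌈M⌉ : ℤ) : ℝ) ≤ m := by push_cast; linarith
    exact_mod_cast this
  · have : (m : ℝ) ≤ ((τ + ⌈M⌉ : ℤ) : ℝ) := by push_cast; linarith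
    exact_mod_cast this

end

/-- Large-sieve density bound: if `-a` is a nonsquare, then for `M` large
(depending only on `a`) and any `τ, N`, the set of `m` with `|m - τ| < M` that
occur in a solution of `a m² + n² = N` has at most `100 √M log M` elements. -/
theorem stmt_14 (a : ℤ) (ha : ¬∃ t : ℤ, t ^ 2 = -a) :
    ∃ K : ℝ, ∀ M : ℝ, K ≤ M → ∀ τ N : ℤ,
      ∃ hfin : {m : ℤ | |(m : ℝ) - (τ : ℝ)| < M ∧
          ∃ n : ℤ, a * m ^ 2 + n ^ 2 = N}.Finite,
        (({m : ℤ | |(m : ℝ) - (τ : ℝ)| < M ∧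
            ∃ n : ℤ, a * m ^ 2 + n ^ 2 = N}.ncard : ℝ)) ≤
          100 * Real.sqrt M * Real.log M := by
  classical
  have hsq : ¬IsSquare (-a) := fun ⟨t, ht⟩ ↦ ha ⟨t, by rw [ht, sq]⟩
  obtain ⟨K, N₀, hK, hwin⟩ := exists_one_le_sum_log_div_nonsquare hsq
  obtain ⟨Q₀, hpairs⟩ := exists_card_pairs_ge hK hwin 18
  refine ⟨max 9 (Q₀ ^ 2), fun M hM τ N ↦ ?_⟩
  have hM9 : 9 ≤ M := (le_max_left _ _).trans hM
  have hMQ₀ : (Q₀ : ℝ) ^ 2 ≤ M := (le_max_right _ _).trans hM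
  have hfin : {m : ℤ | |(m : ℝ) - (τ : ℝ)| < M ∧ ∃ n : ℤ, a * m ^ 2 + n ^ 2 = N}.Finite :=
    (finite_setOf_abs_sub_lt M τ).subset fun m hm ↦ hm.1
  refine ⟨hfin, ?_⟩
  set T := hfin.toFinset with hTdef
  have hT : ∀ m ∈ T, |(m : ℝ) - τ| < M ∧ ∃ n : ℤ, a * m ^ 2 + n ^ 2 = N := fun m hm ↦ by
    simpa [hTdef] using hm
  rw [Set.ncard_eq_toFinset_card _ hfin]
  set r := √M with hr
  have hrsq : r ^ 2 = M := Real.sq_sqrt (by linarith)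
  have hr3 : 3 ≤ r := Real.le_sqrt_of_sq_le (by linarith)
  set Q := ⌈5 / 2 * r⌉₊ with hQ
  have hQle : 5 / 2 * r ≤ Q := Nat.le_ceil _
  have hQlt : (Q : ℝ) < 5 / 2 * r + 1 := Nat.ceil_lt_add_one (by linarith)
  have hQ₀ : Q₀ ≤ Q := by
    have : (Q₀ : ℝ) ≤ Q := by nlinarith
    exact_mod_cast this
  have hQpos : (1 : ℝ) < Q := by linarith
  have hlogQ : 0 < Real.log Q := Real.log_pos hQpos
  obtain ⟨P, hP, hPcard⟩ := hpairs Q hQ₀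
  have hsieve := card_mul_card_le_of_sieve (Q := Q) (by exact_mod_cast zero_lt_one.trans hQpos)
    (T.image (· - τ))
    (by
      intro n hn
      obtain ⟨m, hm, rfl⟩ := Finset.mem_image.mp hn
      have h := (hT m hm).1
      have : 6 * |(m : ℝ) - τ| ≤ (Q : ℝ) ^ 2 := by nlinarith
      exact_mod_cast this)
    P (fun x hx ↦ ⟨(hP x hx).1.1, (hP x hx).2.1.1, (hP x hx).2.2.2⟩)
    (fun x hx ↦ by
      obtain ⟨⟨hp, hps⟩, ⟨hl, hls⟩, h18, hlt, -⟩ := hP x hx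
      exact ⟨card_image_cast_conic_le hp (by omega) N τ hps fun m hm ↦ (hT m hm).2,
        card_image_cast_conic_le hl (by omega) N τ hls fun m hm ↦ (hT m hm).2⟩)
  rw [Finset.card_image_of_injective _ (sub_left_injective)] at hsieve
  have hcard : (T.card : ℝ) ≤ 16 * Q * Real.log Q := by
    have h1 : (T.card : ℝ) * (Q / Real.log Q) ≤ 16 * Q ^ 2 :=
      (mul_le_mul_of_nonneg_left hPcard (Nat.cast_nonneg _)).trans hsieve
    rw [← mul_div_assoc, div_le_iff₀ hlogQ] at h1
    refine le_of_mul_le_mul_right ?_ (zero_lt_one.trans hQpos)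
    linarith
  have hQ3 : (Q : ℝ) ≤ 3 * r := by linarith
  have hlog : Real.log Q ≤ Real.log M := Real.log_le_log (by linarith) (by nlinarith)
  calc (T.card : ℝ) ≤ 16 * Q * Real.log Q := hcard
    _ ≤ 16 * (3 * r) * Real.log M := by gcongr
    _ ≤ 100 * r * Real.log M := by
        have : 0 ≤ r * Real.log M := mul_nonneg (by linarith) (hlogQ.le.trans hlog)
        linarith
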